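/- arXiv:2401.04847 — 2 statements merged into one kernel-verified Lean document; each statement's English description precedes it below -/
import Mathlib

section
/- Let b ∈ ℝ and let (L, U) be a nontrivial complementary pair of X such that L is a minimal lower set with respect to b. Assume that J_L(g, ·) attains its minimum over I_L and that J_U(g, ·) attains its minimum over I_U. Then (L, U) is a projection pair for g with separation constant b. -/
open Pointwise Finset
open scoped Classical

variable {X : Type*}

/-- `f` is isotonic on the subset `S` of `X`. -/
def IsotonicOn [PartialOrder X] (f : X → ℝ) (S : Finset X) : Prop :=
  ∀ x ∈ S, ∀ y ∈ S, x ≤ y → f x ≤ f y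

/-- The separable loss `J_S(g, f) = Σ_{x∈S} ℓ(g(x), f(x))`. -/
noncomputable def lossJ (ℓ : ℝ → ℝ → ℝ) (g : X → ℝ) (S : Finset X) (f : X → ℝ) : ℝ :=
  ∑ x ∈ S, ℓ (g x) (f x)

/-- The subdifferential of the convex function `ℓ(a, ·)` at `b`. -/
def subdiff (ℓ : ℝ → ℝ → ℝ) (a b : ℝ) : Set ℝ :=
  {s : ℝ | ∀ y : ℝ, ℓ a b + s * (y - b) ≤ ℓ a y}

/-- `Σ_b(S) = −Σ_{x∈S} ∂ℓ(g(x), b)` (Minkowski sum; `Σ_b(∅) = {0}`). -/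
noncomputable def SigmaSet (ℓ : ℝ → ℝ → ℝ) (g : X → ℝ) (b : ℝ) (S : Finset X) : Set ℝ :=
  -∑ x ∈ S, subdiff ℓ (g x) b

/-- `U` is an upper set of `X`. -/
def IsUpperFinset [PartialOrder X] (U : Finset X) : Prop :=
  ∀ x ∈ U, ∀ y : X, x ≤ y → y ∈ U

/-- `L` is a lower set of `X`. -/
def IsLowerFinset [PartialOrder X] (L : Finset X) : Prop :=
  ∀ y ∈ L, ∀ x : X, x ≤ y → x ∈ L

/-- `U` is a maximal upper set with respect to `b`:
it maximizes `min Σ_b(U')` over all upper sets `U'`. -/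
def IsMaxUpper [PartialOrder X] (ℓ : ℝ → ℝ → ℝ) (g : X → ℝ) (b : ℝ) (U : Finset X) : Prop :=
  IsUpperFinset U ∧ ∀ U' : Finset X, IsUpperFinset U' →
    sInf (SigmaSet ℓ g b U') ≤ sInf (SigmaSet ℓ g b U)

/-- `L` is a minimal lower set with respect to `b`:
it minimizes `max Σ_b(L')` over all lower sets `L'`. -/
def IsMinLower [PartialOrder X] (ℓ : ℝ → ℝ → ℝ) (g : X → ℝ) (b : ℝ) (L : Finset X) : Prop :=
  IsLowerFinset L ∧ ∀ L' : Finset X, IsLowerFinset L' →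
    sSup (SigmaSet ℓ g b L) ≤ sSup (SigmaSet ℓ g b L')

/-- A finite convex function on `ℝ` has a smallest subgradient at every point. -/
theorem exists_isLeast_subdiff {ℓ : ℝ → ℝ → ℝ} {a : ℝ}
    (hconv : ConvexOn ℝ (Set.univ : Set ℝ) (ℓ a)) (b : ℝ) :
    ∃ d, IsLeast (subdiff ℓ a b) d := by
  set A : Set ℝ := (fun y => (ℓ a b - ℓ a y) / (b - y)) '' Set.Iio b
  have hne : A.Nonempty := ⟨_, b - 1, by simp, rfl⟩
  have hle : ∀ y, b < y → ∀ s ∈ A, s ≤ (ℓ a y - ℓ a b) / (y - b) := by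
    rintro y hy _ ⟨z, hz, rfl⟩
    exact hconv.slope_mono_adjacent (Set.mem_univ z) (Set.mem_univ y) hz hy
  have hbdd : BddAbove A := ⟨_, hle (b + 1) (by linarith)⟩
  refine ⟨sSup A, fun y => ?_, fun s hs => csSup_le hne ?_⟩
  · rcases lt_trichotomy y b with hy | rfl | hy
    · have h := le_csSup hbdd ⟨y, hy, rfl⟩
      rw [div_le_iff₀ (by linarith)] at h
      linarith
    · simp
    · have h := csSup_le hne (hle y hy)
      rw [le_div_iff₀ (by linarith)] at h
      linarith
  · rintro _ ⟨y, hy, rfl⟩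
    have hy' : y < b := hy
    have h := hs y
    rw [div_le_iff₀ (by linarith)]
    linarith

theorem sSup_SigmaSet {ℓ : ℝ → ℝ → ℝ} {g : X → ℝ} {b : ℝ} {d : X → ℝ}
    (hd : ∀ x, IsLeast (subdiff ℓ (g x) b) (d x)) (S : Finset X) :
    sSup (SigmaSet ℓ g b S) = -∑ x ∈ S, d x := by
  refine IsGreatest.csSup_eq ⟨?_, fun s hs => ?_⟩
  · rw [SigmaSet, Set.neg_mem_neg]
    exact Set.finsetSum_mem_finsetSum _ _ _ fun x _ => (hd x).1
  · rw [SigmaSet, Set.mem_neg, Set.mem_finsetSum] at hs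
    obtain ⟨e, he, hes⟩ := hs
    have := Finset.sum_le_sum fun x (hx : x ∈ S) => (hd x).2 (he hx)
    linarith

/-- If the weights `c` have nonnegative sum over every superlevel set of a nonnegative
function `p`, then the weighted sum of `p` is nonnegative. -/
theorem sum_mul_nonneg_of_superlevel (c : X → ℝ) (A : Finset X) (p : X → ℝ)
    (hp : ∀ x ∈ A, 0 ≤ p x) (h : ∀ t, 0 ≤ t → 0 ≤ ∑ x ∈ A with t < p x, c x) :
    0 ≤ ∑ x ∈ A, c x * p x := by
  induction A using Finset.strongInduction generalizing p with
  | H A ih =>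
    rcases A.eq_empty_or_nonempty with rfl | hA
    · simp
    obtain ⟨y, hy, hmin⟩ := A.exists_min_image p hA
    have hm : 0 ≤ p y := hp y hy
    have hrest : 0 ≤ ∑ x ∈ A with p y < p x, c x * (p x - p y) := by
      refine ih {x ∈ A | p y < p x} (Finset.filter_ssubset.2 ⟨y, hy, lt_irrefl _⟩) (fun x => p x - p y)
        (fun x hx => by linarith [(Finset.mem_filter.1 hx).2]) fun t ht => ?_
      convert h (t + p y) (by linarith) using 2
      ext x
      simp only [Finset.mem_filter]
      constructor
      · rintro ⟨⟨h1, h2⟩, h3⟩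
        exact ⟨h1, by linarith⟩
      · rintro ⟨h1, h2⟩
        exact ⟨⟨h1, by linarith⟩, by linarith⟩
    have hbase : 0 ≤ p y * ∑ x ∈ A, c x := by
      rcases hm.eq_or_lt with h0 | h0
      · simp [← h0]
      · have := h 0 le_rfl
        rw [Finset.filter_true_of_mem fun x hx => h0.trans_le (hmin x hx)] at this
        exact mul_nonneg hm this
    have hfilter : ∑ x ∈ A with p y < p x, c x * (p x - p y)
        = ∑ x ∈ A, c x * (p x - p y) := by
      refine Finset.sum_filter_of_ne fun x hx hne => lt_of_le_of_ne (hmin x hx) fun heq => hne ?_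
      rw [heq]
      ring
    have hsplit : ∑ x ∈ A, c x * p x = ∑ x ∈ A, c x * (p x - p y) + p y * ∑ x ∈ A, c x := by
      rw [Finset.mul_sum, ← Finset.sum_add_distrib]
      exact Finset.sum_congr rfl fun x _ => by ring
    linarith

/-- Truncating from above by `b` does not increase the loss when the subgradients at `b`
have nonnegative sum over every relative upper set. -/
theorem lossJ_min_le {ℓ : ℝ → ℝ → ℝ} {g : X → ℝ} {b : ℝ} {d : X → ℝ}
    (hd : ∀ x, d x ∈ subdiff ℓ (g x) b) {S : Finset X} {f : X → ℝ}
    (h : ∀ t, 0 ≤ t → 0 ≤ ∑ x ∈ S with b + t < f x, d x) :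
    lossJ ℓ g S (fun x => min (f x) b) ≤ lossJ ℓ g S f := by
  have hsum : 0 ≤ ∑ x ∈ S, d x * max (f x - b) 0 := by
    refine sum_mul_nonneg_of_superlevel d S _ (fun _ _ => le_max_right _ _) fun t ht => ?_
    convert h t ht using 3
    rw [lt_max_iff, lt_sub_iff_add_lt', or_iff_left ht.not_gt]
  have hpt : ∀ x ∈ S, ℓ (g x) (min (f x) b) + d x * max (f x - b) 0 ≤ ℓ (g x) (f x) := by
    intro x _
    rcases le_total (f x) b with hx | hx
    · simp [hx]
    · simpa [hx] using hd x (f x)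
  have := Finset.sum_le_sum hpt
  rw [Finset.sum_add_distrib] at this
  unfold lossJ
  linarith

/-- Truncating from below by `b` does not increase the loss when the subgradients at `b`
have nonpositive sum over every relative lower set. -/
theorem lossJ_max_le {ℓ : ℝ → ℝ → ℝ} {g : X → ℝ} {b : ℝ} {d : X → ℝ}
    (hd : ∀ x, d x ∈ subdiff ℓ (g x) b) {S : Finset X} {f : X → ℝ}
    (h : ∀ t, 0 ≤ t → ∑ x ∈ S with f x < b - t, d x ≤ 0) :
    lossJ ℓ g S (fun x => max (f x) b) ≤ lossJ ℓ g S f := by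
  have hsum : 0 ≤ ∑ x ∈ S, -d x * max (b - f x) 0 := by
    refine sum_mul_nonneg_of_superlevel (fun x => -d x) S _ (fun _ _ => le_max_right _ _)
      fun t ht => ?_
    rw [Finset.sum_neg_distrib, neg_nonneg]
    convert h t ht using 3
    rw [lt_max_iff, lt_sub_comm, or_iff_left ht.not_gt]
  have hpt : ∀ x ∈ S, ℓ (g x) (max (f x) b) + -d x * max (b - f x) 0 ≤ ℓ (g x) (f x) := by
    intro x _
    rcases le_total (f x) b with hx | hx
    · have := hd x (f x)
      rw [max_eq_right hx, max_eq_left (by linarith)]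
      linarith
    · simp [hx]
  have := Finset.sum_le_sum hpt
  rw [Finset.sum_add_distrib] at this
  unfold lossJ
  linarith

/-- If `(L, U)` is a nontrivial complementary pair with `L` a minimal
lower set w.r.t. `b`, and the restricted problems attain their minima, then `(L, U)`
is a projection pair for `g` with separation constant `b`. -/
theorem minimal_lower_set_gives_projection_pair
    [Fintype X] [Nonempty X] [PartialOrder X]
    (ℓ : ℝ → ℝ → ℝ) (hconv : ∀ a : ℝ, ConvexOn ℝ (Set.univ : Set ℝ) (ℓ a))
    (g : X → ℝ) (b : ℝ) (U L : Finset X)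
    (hUupper : IsUpperFinset U) (hLcompl : L = Finset.univ \ U)
    (hUne : U.Nonempty) (hLne : L.Nonempty)
    (hmin : IsMinLower ℓ g b L)
    (hattL : ∃ f : X → ℝ, IsotonicOn f L ∧
      ∀ h : X → ℝ, IsotonicOn h L → lossJ ℓ g L f ≤ lossJ ℓ g L h)
    (hattU : ∃ f : X → ℝ, IsotonicOn f U ∧
      ∀ h : X → ℝ, IsotonicOn h U → lossJ ℓ g U f ≤ lossJ ℓ g U h) :
    ∃ gL gU : X → ℝ,
      (IsotonicOn gL L ∧
        ∀ h : X → ℝ, IsotonicOn h L → lossJ ℓ g L gL ≤ lossJ ℓ g L h) ∧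
      (IsotonicOn gU U ∧
        ∀ h : X → ℝ, IsotonicOn h U → lossJ ℓ g U gU ≤ lossJ ℓ g U h) ∧
      (∀ x ∈ L, gL x ≤ b) ∧ (∀ x ∈ U, b ≤ gU x) := by
  choose d hd using fun x => exists_isLeast_subdiff (hconv (g x)) b
  obtain ⟨hLlower, hmax⟩ := hmin
  simp only [sSup_SigmaSet hd, neg_le_neg_iff] at hmax
  have hdisj : Disjoint L U := hLcompl ▸ Finset.sdiff_disjoint
  have hcover : ∀ x, x ∉ L → x ∈ U := fun x hx => by simpa [hLcompl] using hx
  obtain ⟨fL, hfL, hfLmin⟩ := hattL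
  obtain ⟨fU, hfU, hfUmin⟩ := hattU
  refine ⟨fun x => min (fL x) b, fun x => max (fU x) b,
    ⟨fun x hx y hy hxy => min_le_min_right b (hfL x hx y hy hxy),
      fun h hh => (lossJ_min_le (fun x => (hd x).1) fun t _ => ?_).trans (hfLmin h hh)⟩,
    ⟨fun x hx y hy hxy => max_le_max_right b (hfU x hx y hy hxy),
      fun h hh => (lossJ_max_le (fun x => (hd x).1) fun t _ => ?_).trans (hfUmin h hh)⟩,
    fun x _ => min_le_right _ _, fun x _ => le_max_right _ _⟩
  · have hlow : IsLowerFinset {x ∈ L | ¬ b + t < fL x} := by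
      intro y hy x hxy
      rw [Finset.mem_filter] at hy ⊢
      have hx := hLlower y hy.1 x hxy
      exact ⟨hx, fun hlt => hy.2 (hlt.trans_le (hfL x hx y hy.1 hxy))⟩
    have hle := hmax _ hlow
    have hsplit := Finset.sum_filter_add_sum_filter_not L (fun x => b + t < fL x) d
    linarith
  · have hlow : IsLowerFinset (L ∪ {x ∈ U | fU x < b - t}) := by
      intro y hy x hxy
      by_cases hxL : x ∈ L
      · exact Finset.mem_union_left _ hxL
      rcases Finset.mem_union.1 hy with hyL | hyU
      · exact Finset.mem_union_left _ (hLlower y hyL x hxy)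
      · rw [Finset.mem_filter] at hyU
        have hxU := hcover x hxL
        exact Finset.mem_union_right _ (Finset.mem_filter.2
          ⟨hxU, (hfU x hxU y hyU.1 hxy).trans_lt hyU.2⟩)
    have hle := hmax _ hlow
    rw [Finset.sum_union (hdisj.mono_right (Finset.filter_subset _ _))] at hle
    linarith
end

section
/- Let b ∈ Cf_g(X). Then there exist an upper set U and a lower set L of X such that U is a maximal upper set with respect to b, L is a minimal lower set with respect to b, and L ∩ U = ∅. -/
open Pointwise Finset
open scoped Classical

variable {X : Type*}

lemma subdiff_nonempty (ℓ : ℝ → ℝ → ℝ) (a b : ℝ)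
    (h : ConvexOn ℝ (Set.univ : Set ℝ) (ℓ a)) : (subdiff ℓ a b).Nonempty := by
  have hmem : ∀ z : ℝ, z ∈ interior (Set.univ : Set ℝ) := by simp
  refine ⟨derivWithin (ℓ a) (Set.Ioi b) b, fun y => ?_⟩
  rcases lt_trichotomy b y with hby | rfl | hyb
  · have hs := h.rightDeriv_le_slope_of_mem_interior (hmem b) (Set.mem_univ y) hby
    rw [slope_def_field, le_div_iff₀ (sub_pos.2 hby)] at hs
    linarith
  · simp
  · have hs := (h.slope_le_leftDeriv_of_mem_interior (Set.mem_univ y) (hmem b) hyb).trans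
      (h.leftDeriv_le_rightDeriv_of_mem_interior (hmem b))
    rw [slope_def_field, div_le_iff₀ (sub_pos.2 hyb)] at hs
    linarith

lemma bddAbove_subdiff (ℓ : ℝ → ℝ → ℝ) (a b : ℝ) : BddAbove (subdiff ℓ a b) := by
  refine ⟨ℓ a (b + 1) - ℓ a b, fun s hs => ?_⟩
  have := hs (b + 1)
  linarith

lemma bddBelow_subdiff (ℓ : ℝ → ℝ → ℝ) (a b : ℝ) : BddBelow (subdiff ℓ a b) := by
  refine ⟨ℓ a b - ℓ a (b - 1), fun s hs => ?_⟩
  have := hs (b - 1)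
  linarith

lemma nonempty_bddAbove_csSup_sum {ι : Type*} (A : ι → Set ℝ)
    (hne : ∀ i, (A i).Nonempty) (hbdd : ∀ i, BddAbove (A i)) (S : Finset ι) :
    (∑ i ∈ S, A i).Nonempty ∧ BddAbove (∑ i ∈ S, A i) ∧
      sSup (∑ i ∈ S, A i) = ∑ i ∈ S, sSup (A i) := by
  induction S using Finset.induction_on with
  | empty => exact ⟨by simp, ⟨0, by simp [upperBounds]⟩, by simp⟩
  | insert i S hi ih =>
    obtain ⟨hn, hb, hs⟩ := ih
    simp only [Finset.sum_insert hi]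
    exact ⟨(hne i).add hn, (hbdd i).add hb, by rw [csSup_add (hne i) (hbdd i) hn hb, hs]⟩

lemma sInf_sigmaSet (ℓ : ℝ → ℝ → ℝ) (hconv : ∀ a : ℝ, ConvexOn ℝ (Set.univ : Set ℝ) (ℓ a))
    (g : X → ℝ) (b : ℝ) (S : Finset X) :
    sInf (SigmaSet ℓ g b S) = -∑ x ∈ S, sSup (subdiff ℓ (g x) b) := by
  rw [SigmaSet, Real.sInf_neg, (nonempty_bddAbove_csSup_sum _
    (fun x => subdiff_nonempty ℓ (g x) b (hconv _)) (fun x => bddAbove_subdiff ℓ (g x) b) S).2.2]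

lemma sSup_sigmaSet (ℓ : ℝ → ℝ → ℝ) (hconv : ∀ a : ℝ, ConvexOn ℝ (Set.univ : Set ℝ) (ℓ a))
    (g : X → ℝ) (b : ℝ) (S : Finset X) :
    sSup (SigmaSet ℓ g b S) = -∑ x ∈ S, sInf (subdiff ℓ (g x) b) := by
  have hsum := (nonempty_bddAbove_csSup_sum (fun x => -subdiff ℓ (g x) b)
    (fun x => (subdiff_nonempty ℓ (g x) b (hconv _)).neg)
    (fun x => (bddBelow_subdiff ℓ (g x) b).neg) S).2.2
  rw [SigmaSet, ← Finset.sum_neg_distrib, ← Finset.sum_neg_distrib, hsum]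
  refine Finset.sum_congr rfl fun x _ => ?_
  rw [← neg_neg (sSup (-subdiff ℓ (g x) b)), ← Real.sInf_neg, neg_neg]

lemma IsUpperFinset.sdiff [PartialOrder X] {U L : Finset X} (hU : IsUpperFinset U)
    (hL : IsLowerFinset L) : IsUpperFinset (U \ L) := by
  intro x hx y hxy
  rw [Finset.mem_sdiff] at hx ⊢
  exact ⟨hU x hx.1 y hxy, fun hy => hx.2 (hL y hy x hxy)⟩

lemma IsLowerFinset.sdiff [PartialOrder X] {U L : Finset X} (hL : IsLowerFinset L)
    (hU : IsUpperFinset U) : IsLowerFinset (L \ U) := by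
  intro y hy x hxy
  rw [Finset.mem_sdiff] at hy ⊢
  exact ⟨hL y hy.1 x hxy, fun hx => hy.2 (hU x hx y hxy)⟩

lemma exists_isMaxUpper [Fintype X] [PartialOrder X] (ℓ : ℝ → ℝ → ℝ) (g : X → ℝ) (b : ℝ) :
    ∃ U : Finset X, IsMaxUpper ℓ g b U :=
  Set.exists_max_image {U : Finset X | IsUpperFinset U} (fun U => sInf (SigmaSet ℓ g b U))
    (Set.toFinite _) ⟨∅, by simp [IsUpperFinset]⟩

lemma exists_isMinLower [Fintype X] [PartialOrder X] (ℓ : ℝ → ℝ → ℝ) (g : X → ℝ) (b : ℝ) :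
    ∃ L : Finset X, IsMinLower ℓ g b L :=
  Set.exists_min_image {L : Finset X | IsLowerFinset L} (fun L => sSup (SigmaSet ℓ g b L))
    (Set.toFinite _) ⟨∅, by simp [IsLowerFinset]⟩

/-- For `b ∈ Cf_g(X)` there exist a maximal upper set `U` and a minimal
lower set `L` w.r.t. `b` that are disjoint. -/
theorem disjoint_maximal_upper_minimal_lower
    [Fintype X] [Nonempty X] [PartialOrder X]
    (ℓ : ℝ → ℝ → ℝ) (hconv : ∀ a : ℝ, ConvexOn ℝ (Set.univ : Set ℝ) (ℓ a))
    (g : X → ℝ) (b : ℝ)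
    (hb : ∀ y : ℝ, ∑ x : X, ℓ (g x) b ≤ ∑ x : X, ℓ (g x) y) :
    ∃ U L : Finset X, IsMaxUpper ℓ g b U ∧ IsMinLower ℓ g b L ∧ Disjoint L U := by
  obtain ⟨U, hU, hUmax⟩ := exists_isMaxUpper ℓ g b
  obtain ⟨L, hL, hLmin⟩ := exists_isMinLower ℓ g b
  refine ⟨U \ L, L, ⟨hU.sdiff hL, fun U' hU' => (hUmax U' hU').trans ?_⟩, ⟨hL, hLmin⟩,
    Finset.disjoint_sdiff⟩
  have hlow := hLmin _ (hL.sdiff hU)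
  simp only [sSup_sigmaSet ℓ hconv, sInf_sigmaSet ℓ hconv] at hlow ⊢
  have hsplitU := Finset.sum_inter_add_sum_sdiff U L fun x => sSup (subdiff ℓ (g x) b)
  have hsplitL := Finset.sum_inter_add_sum_sdiff L U fun x => sInf (subdiff ℓ (g x) b)
  rw [Finset.inter_comm] at hsplitL
  have hle : ∑ x ∈ U ∩ L, sInf (subdiff ℓ (g x) b) ≤ ∑ x ∈ U ∩ L, sSup (subdiff ℓ (g x) b) :=
    Finset.sum_le_sum fun x _ => csInf_le_csSup (subdiff_nonempty ℓ (g x) b (hconv _))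
      (bddBelow_subdiff ℓ (g x) b) (bddAbove_subdiff ℓ (g x) b)
  linarith
end
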